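/- Fix ρ_c > 0 and ε ∈ ℝ. With f, a and ρ̂₁ as follows: f(v) = (27/8)·|v|·| |v+1|^{1/3} − |v−1|^{1/3} |³ · |v|·| |v+1| − |v−1| |, a(n) = f(ε+4n+2), and (ρ̂₁ψ)(n) = (ρ_c/8)·[(a(n−1)+a(n))ψ(n) − a(n−1)ψ(n−1) − a(n)ψ(n+1)] on ℓ²(ℤ,ℂ). Then the closed interval [0, ρ_c] is contained in the spectrum of ρ̂₁. -/

import Mathlib

/-- `f(v) = B_APS(v)·Ã_APS(v)
  = (27/8)·|v|·| |v+1|^(1/3) − |v−1|^(1/3) |³ · |v|·| |v+1| − |v−1| |`. -/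
noncomputable def fAPS (v : ℝ) : ℝ :=
  (27 / 8) * |v| * (abs (|v + 1| ^ ((1 : ℝ) / 3) - |v - 1| ^ ((1 : ℝ) / 3))) ^ (3 : ℕ)
    * (|v| * abs (|v + 1| - |v - 1|))

/-- The lattice coefficients `a(n) = f(ε+4n+2)`. -/
noncomputable def aAPS (ε : ℝ) (n : ℤ) : ℝ := fAPS (ε + 4 * n + 2)


/-- The value of `fAPS` at `v > 1`, after scaling the cube roots by `v ^ (1/3)`. -/
lemma fAPS_eq_of_one_lt {v : ℝ} (hv : 1 < v) :
    fAPS v = 54 / (((1 + v⁻¹) ^ ((1 : ℝ) / 3)) ^ 2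
      + (1 + v⁻¹) ^ ((1 : ℝ) / 3) * (1 - v⁻¹) ^ ((1 : ℝ) / 3)
      + ((1 - v⁻¹) ^ ((1 : ℝ) / 3)) ^ 2) ^ 3 := by
  have hv0 : 0 < v := by linarith
  have hinv : v⁻¹ < 1 := inv_lt_one_of_one_lt₀ hv
  have hinv0 : 0 < v⁻¹ := inv_pos.2 hv0
  have cube {x : ℝ} (hx : 0 ≤ x) : (x ^ ((1 : ℝ) / 3)) ^ 3 = x := by
    rw [← Real.rpow_natCast, ← Real.rpow_mul hx]; norm_num
  have hp : (v + 1) ^ ((1 : ℝ) / 3) = v ^ ((1 : ℝ) / 3) * (1 + v⁻¹) ^ ((1 : ℝ) / 3) := by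
    rw [← Real.mul_rpow hv0.le (by linarith)]
    congr 1; field_simp
  have hq : (v - 1) ^ ((1 : ℝ) / 3) = v ^ ((1 : ℝ) / 3) * (1 - v⁻¹) ^ ((1 : ℝ) / 3) := by
    rw [← Real.mul_rpow hv0.le (by linarith)]
    congr 1; field_simp
  have hr := cube hv0.le
  have hs := cube (x := 1 + v⁻¹) (by linarith)
  have ht := cube (x := 1 - v⁻¹) (by linarith)
  have hs0 : 0 < (1 + v⁻¹) ^ ((1 : ℝ) / 3) := Real.rpow_pos_of_pos (by linarith) _
  have ht0 : 0 < (1 - v⁻¹) ^ ((1 : ℝ) / 3) := Real.rpow_pos_of_pos (by linarith) _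
  have hle : (v - 1) ^ ((1 : ℝ) / 3) ≤ (v + 1) ^ ((1 : ℝ) / 3) :=
    Real.rpow_le_rpow (by linarith) (by linarith) (by norm_num)
  have h2 : |v + 1| - |v - 1| = 2 := by
    rw [abs_of_pos (by linarith), abs_of_pos (by linarith)]; ring
  rw [fAPS, h2, abs_of_pos hv0, abs_of_pos (show 0 < v + 1 by linarith),
    abs_of_pos (show 0 < v - 1 by linarith), abs_of_nonneg (sub_nonneg.2 hle), hp, hq]
  generalize (1 + v⁻¹) ^ ((1 : ℝ) / 3) = s at *
  generalize (1 - v⁻¹) ^ ((1 : ℝ) / 3) = t at *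
  generalize v ^ ((1 : ℝ) / 3) = r at *
  have hdiff : v * ((s - t) * (s ^ 2 + s * t + t ^ 2)) = 2 := by
    have : (s - t) * (s ^ 2 + s * t + t ^ 2) = 2 * v⁻¹ := by linear_combination hs - ht
    rw [this]; field_simp
  have hQ : 0 < s ^ 2 + s * t + t ^ 2 := by positivity
  rw [eq_div_iff (by positivity), abs_of_pos (by norm_num : (0 : ℝ) < 2)]
  calc 27 / 8 * v * (r * s - r * t) ^ 3 * (v * 2) * (s ^ 2 + s * t + t ^ 2) ^ 3
      = 27 / 4 * (r ^ 3 * v ^ 2 * ((s - t) * (s ^ 2 + s * t + t ^ 2)) ^ 3) := by ring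
    _ = 27 / 4 * (v * ((s - t) * (s ^ 2 + s * t + t ^ 2))) ^ 3 := by rw [hr]; ring
    _ = 54 := by rw [hdiff]; norm_num

lemma tendsto_fAPS_atTop : Filter.Tendsto fAPS Filter.atTop (nhds 2) := by
  have hs : Filter.Tendsto (fun v : ℝ => (1 + v⁻¹) ^ ((1 : ℝ) / 3)) Filter.atTop (nhds 1) := by
    have h := (tendsto_inv_atTop_zero (𝕜 := ℝ)).const_add 1
    simpa using h.rpow_const (p := (1 : ℝ) / 3) (Or.inr (by norm_num))
  have ht : Filter.Tendsto (fun v : ℝ => (1 - v⁻¹) ^ ((1 : ℝ) / 3)) Filter.atTop (nhds 1) := by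
    have h := (tendsto_inv_atTop_zero (𝕜 := ℝ)).const_sub 1
    simpa using h.rpow_const (p := (1 : ℝ) / 3) (Or.inr (by norm_num))
  have h := (tendsto_const_nhds (x := (54 : ℝ))).div
    ((((hs.pow 2).add (hs.mul ht)).add (ht.pow 2)).pow 3) (by norm_num)
  norm_num at h
  refine h.congr' ?_
  filter_upwards [Filter.eventually_gt_atTop 1] with v hv
  rw [fAPS_eq_of_one_lt hv]
  norm_num

lemma tendsto_aAPS_atTop (ε : ℝ) : Filter.Tendsto (aAPS ε) Filter.atTop (nhds 2) := by
  refine tendsto_fAPS_atTop.comp (Filter.tendsto_atTop_add_const_right _ _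
    (Filter.tendsto_atTop_add_const_left _ _ ?_))
  exact tendsto_intCast_atTop_atTop.const_mul_atTop (by norm_num)

/-- The plane wave `n ↦ exp (i n θ)` cut off to the interval `[M + 1, M + N]`. -/
noncomputable def truncatedWave (θ : ℝ) (M : ℤ) (N : ℕ) (n : ℤ) : ℂ :=
  if n ∈ Finset.Icc (M + 1) (M + N) then Complex.exp ((n * θ : ℝ) * Complex.I) else 0

lemma norm_truncatedWave_of_mem {θ : ℝ} {M : ℤ} {N : ℕ} {n : ℤ}
    (hn : n ∈ Finset.Icc (M + 1) (M + N)) : ‖truncatedWave θ M N n‖ = 1 := by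
  rw [truncatedWave, if_pos hn, Complex.norm_exp_ofReal_mul_I]

lemma truncatedWave_of_notMem {θ : ℝ} {M : ℤ} {N : ℕ} {n : ℤ}
    (hn : n ∉ Finset.Icc (M + 1) (M + N)) : truncatedWave θ M N n = 0 := if_neg hn

lemma norm_truncatedWave_le_one (θ : ℝ) (M : ℤ) (N : ℕ) (n : ℤ) :
    ‖truncatedWave θ M N n‖ ≤ 1 := by
  by_cases hn : n ∈ Finset.Icc (M + 1) (M + N)
  · exact (norm_truncatedWave_of_mem hn).le
  · simp [truncatedWave_of_notMem hn]

lemma memℓp_truncatedWave (θ : ℝ) (M : ℤ) (N : ℕ) : Memℓp (truncatedWave θ M N) 2 := by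
  refine memℓp_gen (summable_of_ne_finset_zero (s := Finset.Icc (M + 1) (M + N)) fun n hn => ?_)
  simp [truncatedWave_of_notMem hn]

lemma lp_two_norm_sq_eq_sum {ι : Type*} {f : lp (fun _ : ι => ℂ) 2} {s : Finset ι}
    (hf : ∀ i ∉ s, f i = 0) : ‖f‖ ^ 2 = ∑ i ∈ s, ‖f i‖ ^ 2 := by
  have h := lp.norm_rpow_eq_tsum (p := 2) (by norm_num) f
  norm_num at h
  rw [h]
  exact tsum_eq_sum fun i hi => by simp [hf i hi]

/-- Away from the cut-offs, the truncated plane wave is a generalized eigenvector of the discrete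
Laplacian. -/
lemma two_mul_cos_mul_truncatedWave {θ : ℝ} {M : ℤ} {N : ℕ} {n : ℤ}
    (h₁ : M + 2 ≤ n) (h₂ : n + 1 ≤ M + N) :
    2 * (Real.cos θ : ℂ) * truncatedWave θ M N n
      = truncatedWave θ M N (n - 1) + truncatedWave θ M N (n + 1) := by
  unfold truncatedWave
  rw [if_pos (by simp; omega), if_pos (by simp; omega), if_pos (by simp; omega),
    Complex.ofReal_cos, Complex.two_cos, add_mul, ← Complex.exp_add, ← Complex.exp_add, add_comm]
  push_cast
  congr 2 <;> ring

lemma norm_four_term_le {a b w x y : ℂ} {A : ℝ} (ha : ‖a‖ ≤ A) (hb : ‖b‖ ≤ A)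
    (hw : ‖w‖ ≤ 1) (hx : ‖x‖ ≤ 1) (hy : ‖y‖ ≤ 1) :
    ‖(a + b) * w - a * x - b * y‖ ≤ 4 * A := by
  have h {c z : ℂ} (hc : ‖c‖ ≤ A) (hz : ‖z‖ ≤ 1) : ‖c * z‖ ≤ A := by
    rw [norm_mul]; nlinarith [norm_nonneg c, norm_nonneg z]
  rw [add_mul]
  linarith [norm_sub_le (a * w + b * w - a * x) (b * y), norm_sub_le (a * w + b * w) (a * x),
    norm_add_le (a * w) (b * w), h ha hw, h hb hw, h ha hx, h hb hy]

/-- If the coefficients of a weighted discrete Laplacian on `ℓ²(ℤ)` tend to `α` at `+∞`, then every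
`2α(1 - cos θ)` is in its spectrum. -/
lemma two_mul_one_sub_cos_mem_spectrum {a : ℤ → ℝ} {α : ℝ}
    (ha : Filter.Tendsto a Filter.atTop (nhds α))
    (T : lp (fun _ : ℤ => ℂ) 2 →L[ℂ] lp (fun _ : ℤ => ℂ) 2)
    (hT : ∀ ψ : lp (fun _ : ℤ => ℂ) 2, ∀ n : ℤ,
      T ψ n = ((a (n - 1) : ℂ) + a n) * ψ n - a (n - 1) * ψ (n - 1) - a n * ψ (n + 1))
    (θ : ℝ) : ((2 * α * (1 - Real.cos θ) : ℝ) : ℂ) ∈ spectrum ℂ T := by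
  by_contra hmem
  obtain ⟨u, hu⟩ := spectrum.notMem_iff.1 hmem
  let U : lp (fun _ : ℤ => ℂ) 2 →L[ℂ] lp (fun _ : ℤ => ℂ) 2 := u
  let S : lp (fun _ : ℤ => ℂ) 2 →L[ℂ] lp (fun _ : ℤ => ℂ) 2 := ↑(u⁻¹)
  have hbelow (ψ) : ‖ψ‖ ≤ ‖S‖ * ‖U ψ‖ := by
    have : S (U ψ) = ψ := by
      exact DFunLike.congr_fun u.inv_mul ψ
    simpa [this] using S.le_opNorm (U ψ)
  have hC : 0 ≤ ‖S‖ := norm_nonneg S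
  generalize ‖S‖ = C at hbelow hC
  obtain ⟨δ, hδ, hδ1, hδC⟩ : ∃ δ : ℝ, 0 < δ ∧ δ ≤ 1 ∧ C * (4 * δ) ≤ 1 / 2 := by
    refine ⟨1 / (8 * (C + 1)), by positivity, ?_, ?_⟩
    · rw [div_le_one (by positivity)]; linarith
    · rw [mul_one_div, mul_div_assoc', div_le_iff₀ (by positivity)]; linarith
  obtain ⟨M, hM⟩ : ∃ M : ℤ, ∀ n ≥ M, |a n - α| ≤ δ := by
    obtain ⟨M, hM⟩ := Filter.eventually_atTop.1 (Metric.tendsto_nhds.1 ha δ hδ)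
    exact ⟨M, fun n hn => (hM n hn).le⟩
  set K : ℝ := 4 * |α| + 4 * (|α| + 1) with hK
  obtain ⟨N, hN⟩ := exists_nat_gt (C ^ 2 * (4 * K ^ 2) * 4 / 3 + 1)
  let ψ : lp (fun _ : ℤ => ℂ) 2 := ⟨_, memℓp_truncatedWave θ (M + 1) N⟩
  have hψ (n) : ψ n = truncatedWave θ (M + 1) N n := rfl
  have hψ0 {n : ℤ} (hn : n ∉ Finset.Icc (M + 1 + 1) (M + 1 + N)) : ψ n = 0 :=
    truncatedWave_of_notMem hn
  have hψ1 (n) : ‖ψ n‖ ≤ 1 := norm_truncatedWave_le_one _ _ _ n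
  have hψnorm : ‖ψ‖ ^ 2 = N := by
    rw [lp_two_norm_sq_eq_sum (s := Finset.Icc (M + 1 + 1) (M + 1 + N)) fun i hi => hψ0 hi,
      Finset.sum_congr rfl fun i hi => by rw [hψ, norm_truncatedWave_of_mem hi]]
    simp
  set g := U ψ with hg
  have hgn (n : ℤ) : g n = ((2 * α * (1 - Real.cos θ) : ℝ) : ℂ) * ψ n
      - (((a (n - 1) : ℂ) + a n) * ψ n - a (n - 1) * ψ (n - 1) - a n * ψ (n + 1)) := by
    rw [← hT ψ n, hg, show U = _ from hu]
    simp only [Algebra.algebraMap_eq_smul_one, sub_apply]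
    rfl
  have hg0 : ∀ n ∉ Finset.Icc (M + 1) (M + N + 2), g n = 0 := by
    intro n hn
    rw [Finset.mem_Icc] at hn
    rw [hgn, hψ0 (by rw [Finset.mem_Icc]; omega), hψ0 (by rw [Finset.mem_Icc]; omega),
      hψ0 (by rw [Finset.mem_Icc]; omega)]
    simp
  have hgK {n : ℤ} (hn : M + 1 ≤ n) : ‖g n‖ ≤ K := by
    have haA {m : ℤ} (hm : M ≤ m) : ‖(a m : ℂ)‖ ≤ |α| + 1 := by
      rw [Complex.norm_real, Real.norm_eq_abs]
      have := abs_add_le (a m - α) α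
      rw [sub_add_cancel] at this
      linarith [hM m hm]
    have h₁ : ‖((2 * α * (1 - Real.cos θ) : ℝ) : ℂ) * ψ n‖ ≤ 4 * |α| := by
      rw [norm_mul, Complex.norm_real, Real.norm_eq_abs, abs_mul, abs_mul, abs_two,
        abs_of_nonneg (by linarith [Real.cos_le_one θ] : 0 ≤ 1 - Real.cos θ)]
      have h2 : 1 - Real.cos θ ≤ 2 := by linarith [Real.neg_one_le_cos θ]
      calc 2 * |α| * (1 - Real.cos θ) * ‖ψ n‖ ≤ 2 * |α| * 2 * 1 := by
            gcongr
            exact hψ1 n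
        _ = 4 * |α| := by ring
    rw [hgn]
    refine (norm_sub_le _ _).trans ?_
    linarith [norm_four_term_le (haA (m := n - 1) (by omega)) (haA (m := n) (by omega))
      (hψ1 n) (hψ1 (n - 1)) (hψ1 (n + 1))]
  have hgδ {n : ℤ} (h₁ : M + 3 ≤ n) (h₂ : n ≤ M + N) : ‖g n‖ ≤ 4 * δ := by
    have hb {m : ℤ} (hm : M ≤ m) : ‖((a m : ℂ) - α)‖ ≤ δ := by
      rw [← Complex.ofReal_sub, Complex.norm_real]
      exact hM m hm
    have hcos := two_mul_cos_mul_truncatedWave (θ := θ) (M := M + 1) (N := N) (n := n)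
      (by omega) (by omega)
    simp only [← hψ] at hcos
    have : g n = -((((a (n - 1) : ℂ) - α) + (a n - α)) * ψ n - (a (n - 1) - α) * ψ (n - 1)
        - (a n - α) * ψ (n + 1)) := by
      rw [hgn]
      push_cast at hcos ⊢
      linear_combination (-α : ℂ) * hcos
    rw [this, norm_neg]
    exact norm_four_term_le (hb (by omega)) (hb (by omega)) (hψ1 _) (hψ1 _) (hψ1 _)
  have hgnorm : ‖g‖ ^ 2 ≤ (N + 2) * (4 * δ) ^ 2 + 4 * K ^ 2 := by
    set B : Finset ℤ := {M + 1, M + 2, M + N + 1, M + N + 2} with hB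
    have hBcard : (B.card : ℝ) ≤ 4 := by exact_mod_cast Finset.card_le_four
    rw [lp_two_norm_sq_eq_sum hg0]
    calc ∑ n ∈ Finset.Icc (M + 1) (M + N + 2), ‖g n‖ ^ 2
        ≤ ∑ n ∈ Finset.Icc (M + 1) (M + N + 2), ((4 * δ) ^ 2 + if n ∈ B then K ^ 2 else 0) := by
          refine Finset.sum_le_sum fun n hn => ?_
          rw [Finset.mem_Icc] at hn
          split_ifs with hnB
          · have := pow_le_pow_left₀ (norm_nonneg _) (hgK hn.1) 2
            nlinarith
          · simp only [hB, Finset.mem_insert, Finset.mem_singleton, not_or] at hnB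
            rw [add_zero]
            exact pow_le_pow_left₀ (norm_nonneg _) (hgδ (by omega) (by omega)) 2
      _ ≤ (N + 2) * (4 * δ) ^ 2 + 4 * K ^ 2 := by
          rw [Finset.sum_add_distrib]
          refine add_le_add (le_of_eq ?_) ?_
          · have : (M + N + 2 + 1 - (M + 1)).toNat = N + 2 := by omega
            rw [Finset.sum_const, Int.card_Icc, this, nsmul_eq_mul]
            push_cast
            rfl
          · rw [← Finset.sum_filter, Finset.sum_const, nsmul_eq_mul]
            have : (((Finset.Icc (M + 1) (M + N + 2)).filter (· ∈ B)).card : ℝ) ≤ B.card := by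
              exact_mod_cast Finset.card_le_card fun n hn => (Finset.mem_filter.1 hn).2
            exact mul_le_mul_of_nonneg_right (this.trans hBcard) (sq_nonneg K)
  have hsq : (N : ℝ) ≤ C ^ 2 * ‖g‖ ^ 2 := by
    rw [← hψnorm, ← mul_pow]
    exact pow_le_pow_left₀ (norm_nonneg _) (hbelow ψ) 2
  have hCδ : (C * (4 * δ)) ^ 2 ≤ 1 / 4 :=
    (pow_le_pow_left₀ (by positivity) hδC 2).trans (by norm_num)
  have h₁ := mul_le_mul_of_nonneg_left hgnorm (sq_nonneg C)
  have h₂ := mul_le_mul_of_nonneg_left hCδ (by positivity : (0 : ℝ) ≤ N + 2)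
  nlinarith

/-- The closed interval `[0, ρ_c]` is contained in the spectrum of the APS scalar
field energy density operator `ρ̂₁`. -/
theorem stmt10 (ρc : ℝ) (hρc : 0 < ρc) (ε : ℝ)
    (ρ₁ : lp (fun _ : ℤ => ℂ) 2 →L[ℂ] lp (fun _ : ℤ => ℂ) 2)
    (hρ₁ : ∀ ψ : lp (fun _ : ℤ => ℂ) 2, ∀ n : ℤ,
      ρ₁ ψ n = (ρc / 8 : ℂ) * (((aAPS ε (n - 1) : ℝ) + aAPS ε n : ℝ) * ψ n
        - (aAPS ε (n - 1) : ℂ) * ψ (n - 1) - (aAPS ε n : ℂ) * ψ (n + 1))) :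
    (fun x : ℝ => (x : ℂ)) '' Set.Icc 0 ρc ⊆ spectrum ℂ ρ₁ := by
  rintro _ ⟨x, ⟨hx0, hx1⟩, rfl⟩
  have hlim : Filter.Tendsto (fun n => ρc / 8 * aAPS ε n) Filter.atTop (nhds (ρc / 8 * 2)) :=
    (tendsto_aAPS_atTop ε).const_mul _
  have hdiv : x / ρc ≤ 1 := (div_le_one hρc).2 hx1
  have hdiv0 : 0 ≤ x / ρc := div_nonneg hx0 hρc.le
  have h := two_mul_one_sub_cos_mem_spectrum hlim ρ₁
    (fun ψ n => by rw [hρ₁]; push_cast; ring) (Real.arccos (1 - 2 * (x / ρc)))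
  rw [Real.cos_arccos (by linarith) (by linarith)] at h
  convert h using 2
  field_simp
  ring
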